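/- arXiv:0711.1026 — 4 statements merged into one kernel-verified Lean document; each statement's English description precedes it below -/
import Mathlib

section
/- Let k be a field, let ≤ be an arbitrary term order on k[X₁,…,X_m], let I be an ideal of k[X₁,…,X_m], let C ⊆ ℕ^m be the set of leading exponents of nonzero elements of I, and let D = ℕ^m − C. Then for every σ ∈ C there exists a uniquely determined monic polynomial f_σ ∈ I such that (a) the leading exponent of f_σ with respect to ≤ equals σ, and (b) every nonleading exponent of f_σ lies in D. -/
open MvPolynomial Finsupp

/-- The total degree `|γ|` of an exponent vector `γ ∈ ℕ^m`. -/
def degOf {m : ℕ} (γ : Fin m →₀ ℕ) : ℕ := γ.sum fun _ e => e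

/-- A term order on `k[X₁,…,X_m]`: a total order on the exponents `ℕ^m`
(equivalently, on monomials) which is compatible with addition (multiplication of
monomials) and has `0` (the monomial `1`) as least element. -/
structure TermOrder (m : ℕ) : Type where
  le : (Fin m →₀ ℕ) → (Fin m →₀ ℕ) → Prop
  le_refl : ∀ a, le a a
  le_trans : ∀ {a b c}, le a b → le b c → le a c
  le_antisymm : ∀ {a b}, le a b → le b a → a = b
  le_total : ∀ a b, le a b ∨ le b a
  add_le_add_right : ∀ {a b} (c), le a b → le (a + c) (b + c)
  zero_le : ∀ a, le 0 a

/-- The statement that `X₁ < X₂ < … < X_m` for a term order on `k[X₁,…,X_m]`. -/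
def TermOrder.VarAsc {m : ℕ} (ord : TermOrder m) : Prop :=
  ∀ i j : Fin m, i < j → ord.le (Finsupp.single i 1) (Finsupp.single j 1)

/-- `σ` is the leading exponent of `f` w.r.t. the order `le` on exponents:
it occurs in `f` with nonzero coefficient and dominates every exponent of `f`. -/
def IsMaxExp {k : Type*} [CommSemiring k] {m : ℕ}
    (le : (Fin m →₀ ℕ) → (Fin m →₀ ℕ) → Prop)
    (f : MvPolynomial (Fin m) k) (σ : Fin m →₀ ℕ) : Prop :=
  σ ∈ f.support ∧ ∀ τ ∈ f.support, le τ σ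

/-- The set `C(S)` of leading exponents of (nonzero) elements of a set `S` of polynomials. -/
def leadExps {k : Type*} [CommSemiring k] {m : ℕ}
    (le : (Fin m →₀ ℕ) → (Fin m →₀ ℕ) → Prop)
    (S : Set (MvPolynomial (Fin m) k)) : Set (Fin m →₀ ℕ) :=
  {σ | ∃ f ∈ S, IsMaxExp le f σ}

/-- `γ <_lex δ`: the strict lexicographic order where `X₁ < … < X_m`, i.e. comparison
is by the *largest* index at which the exponents differ. -/
def lexLt {m : ℕ} (γ δ : Fin m →₀ ℕ) : Prop :=
  ∃ j, γ j < δ j ∧ ∀ i, j < i → γ i = δ i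

/-- The lexicographic order with `X₁ < … < X_m`. -/
def lexLe {m : ℕ} (γ δ : Fin m →₀ ℕ) : Prop := γ = δ ∨ lexLt γ δ

/-- The graded lexicographic order with `X₁ ≺ … ≺ X_m`: compare total degrees first,
break ties lexicographically. -/
def degLexLe {m : ℕ} (γ δ : Fin m →₀ ℕ) : Prop :=
  γ = δ ∨ degOf γ < degOf δ ∨ (degOf γ = degOf δ ∧ lexLt γ δ)

/-- `G` is the reduced Gröbner basis of the ideal `I` w.r.t. the order `le` on exponents:
`G ⊆ I`, `0 ∉ G`, the leading exponent of every nonzero element of `I` is divisible by the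
leading exponent of some `g ∈ G`, every `g ∈ G` is monic, and no monomial occurring in some
`g ∈ G` is divisible by the leading monomial of another element of `G`. -/
structure IsReducedGroebnerBasis {k : Type*} [Field k] {m : ℕ}
    (le : (Fin m →₀ ℕ) → (Fin m →₀ ℕ) → Prop)
    (I : Ideal (MvPolynomial (Fin m) k))
    (G : Finset (MvPolynomial (Fin m) k)) : Prop where
  mem : ∀ g ∈ G, g ∈ I
  ne_zero : ∀ g ∈ G, g ≠ 0
  divides : ∀ f ∈ I, ∀ σ, IsMaxExp le f σ → ∃ g ∈ G, ∃ τ, IsMaxExp le g τ ∧ τ ≤ σ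
  monic : ∀ g ∈ G, ∀ σ, IsMaxExp le g σ → g.coeff σ = 1
  reduced : ∀ g ∈ G, ∀ g' ∈ G, g' ≠ g → ∀ σ ∈ g.support, ∀ τ, IsMaxExp le g' τ → ¬ τ ≤ σ

/-- A line through the origin in `k^m` (through at least one other point). -/
def IsLineThroughOrigin {k : Type*} [Field k] {m : ℕ} (ℓ : Set (Fin m → k)) : Prop :=
  ∃ v : Fin m → k, v ≠ 0 ∧ ℓ = Set.range fun c : k => c • v

/-- The homogenisation `ℋ(f) ∈ k[X₁,…,X_{n+1}]` of `f ∈ k[X₂,…,X_{n+1}]` with respect to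
the extra variable `X₁`: each monomial of `f` is multiplied by the power of `X₁` making
its total degree equal to the total degree of `f`. -/
noncomputable def homog {k : Type*} [CommSemiring k] {n : ℕ}
    (f : MvPolynomial (Fin n) k) : MvPolynomial (Fin (n + 1)) k :=
  f.support.sum fun α =>
    MvPolynomial.monomial
      (Finsupp.single (0 : Fin (n + 1)) (f.totalDegree - degOf α) +
        Finsupp.embDomain (Fin.succEmb n) α)
      (f.coeff α)

/-- The dehomogenisation `h(1, X₂, …, X_{n+1}) ∈ k[X₂,…,X_{n+1}]` of
`h ∈ k[X₁,…,X_{n+1}]`, obtained by substituting `X₁ = 1`. -/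
noncomputable def dehom {k : Type*} [CommSemiring k] {n : ℕ}
    (h : MvPolynomial (Fin (n + 1)) k) : MvPolynomial (Fin n) k :=
  MvPolynomial.aeval (Fin.cases 1 MvPolynomial.X) h

/-- The projection `π : ℕ^{n+1} → ℕ^n` deleting the first coordinate. -/
noncomputable def piProj {n : ℕ} (γ : Fin (n + 1) →₀ ℕ) : Fin n →₀ ℕ :=
  Finsupp.comapDomain Fin.succ γ ((Fin.succ_injective n).injOn)

/-- The embedding `ℕ^n ↪ ℕ^{n+1}`, `α ↦ (0, α)`. -/
noncomputable def embSucc {n : ℕ} (α : Fin n →₀ ℕ) : Fin (n + 1) →₀ ℕ :=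
  Finsupp.embDomain (Fin.succEmb n) α

/-- `L` is the axis `γ + ℕ·e_i` in `ℕ^m` (where `γ_i = 0`), an axis parallel to `ℕ e_i`. -/
def IsAxisThrough {m : ℕ} (L : Set (Fin m →₀ ℕ)) (i : Fin m) (γ : Fin m →₀ ℕ) : Prop :=
  γ i = 0 ∧ L = Set.range fun t : ℕ => γ + Finsupp.single i t

/-- `L` is an axis in `ℕ^m`. -/
def IsAxis {m : ℕ} (L : Set (Fin m →₀ ℕ)) : Prop :=
  ∃ i γ, IsAxisThrough L i γ

namespace TermOrder

variable {m : ℕ} (ord : TermOrder m)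

theorem le_of_le {a b : Fin m →₀ ℕ} (h : a ≤ b) : ord.le a b := by
  have := ord.add_le_add_right a (ord.zero_le (b - a))
  rwa [zero_add, tsub_add_cancel_of_le h] at this

theorem wellFounded_lt : WellFounded fun a b => ord.le a b ∧ ¬ ord.le b a := by
  have : IsPreorder _ ord.le := { refl := ord.le_refl, trans := fun _ _ _ => ord.le_trans }
  have hwqo : WellQuasiOrdered ord.le := fun f => by
    obtain ⟨i, j, hij, h⟩ := wellQuasiOrdered_le f
    exact ⟨i, j, hij, ord.le_of_le h⟩
  exact hwqo.wellFounded

theorem exists_isMaxExp {k : Type*} [CommSemiring k] {f : MvPolynomial (Fin m) k} (hf : f ≠ 0) :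
    ∃ σ, IsMaxExp ord.le f σ := by
  have key : ∀ s : Finset (Fin m →₀ ℕ), s.Nonempty → ∃ σ ∈ s, ∀ τ ∈ s, ord.le τ σ := by
    intro s hs
    induction hs using Finset.Nonempty.cons_induction with
    | singleton a => exact ⟨a, by simp, by simpa using ord.le_refl a⟩
    | cons a s ha hs ih =>
      obtain ⟨σ, hσ, hmax⟩ := ih
      rcases ord.le_total a σ with h | h
      · refine ⟨σ, by simp [hσ], fun τ hτ => ?_⟩
        rcases Finset.mem_cons.1 hτ with rfl | hτ
        exacts [h, hmax τ hτ]
      · refine ⟨a, by simp, fun τ hτ => ?_⟩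
        rcases Finset.mem_cons.1 hτ with rfl | hτ
        exacts [ord.le_refl _, ord.le_trans (hmax τ hτ) h]
  exact key f.support (MvPolynomial.support_nonempty.2 hf)

variable {k : Type*} [Field k] (I : Ideal (MvPolynomial (Fin m) k))

theorem eq_zero_of_support_disjoint_leadExps {f : MvPolynomial (Fin m) k} (hf : f ∈ I)
    (h : ∀ τ ∈ f.support, τ ∉ leadExps ord.le (I : Set (MvPolynomial (Fin m) k))) : f = 0 := by
  by_contra h0
  obtain ⟨σ, hσ⟩ := ord.exists_isMaxExp h0
  exact h σ hσ.1 ⟨f, hf, hσ⟩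

theorem exists_reduced_monic {σ : Fin m →₀ ℕ}
    (hσ : σ ∈ leadExps ord.le (I : Set (MvPolynomial (Fin m) k))) :
    ∃ f ∈ I, IsMaxExp ord.le f σ ∧ f.coeff σ = 1 ∧
      ∀ τ ∈ f.support, τ ≠ σ → τ ∉ leadExps ord.le (I : Set (MvPolynomial (Fin m) k)) := by
  classical
  induction σ using ord.wellFounded_lt.induction with
  | _ σ ih =>
  obtain ⟨f, hfI, hf, hmax⟩ := id hσ
  set S := leadExps ord.le (I : Set (MvPolynomial (Fin m) k))
  have hlt : ∀ τ ∈ f.support, τ ≠ σ → ord.le τ σ ∧ ¬ ord.le σ τ := fun τ hτ hne =>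
    ⟨hmax τ hτ, fun h => hne (ord.le_antisymm (hmax τ hτ) h)⟩
  set T := f.support.filter fun τ => τ ≠ σ ∧ τ ∈ S
  have hg : ∀ τ : Fin m →₀ ℕ, ∃ g : MvPolynomial (Fin m) k, τ ∈ T →
      g ∈ I ∧ IsMaxExp ord.le g τ ∧ g.coeff τ = 1 ∧ ∀ ρ ∈ g.support, ρ ≠ τ → ρ ∉ S := by
    intro τ
    by_cases hτ : τ ∈ T
    · obtain ⟨h1, h2, h3⟩ := Finset.mem_filter.1 hτ
      obtain ⟨g, hg⟩ := ih τ (hlt τ h1 h2) h3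
      exact ⟨g, fun _ => hg⟩
    · exact ⟨0, fun h => absurd h hτ⟩
  choose g hg using hg
  set p := f - ∑ τ ∈ T, C (f.coeff τ) * g τ with hp
  have hcoeff : ∀ ρ, p.coeff ρ = f.coeff ρ - ∑ τ ∈ T, f.coeff τ * (g τ).coeff ρ := fun ρ => by
    simp [hp, coeff_sum, coeff_C_mul]
  have hpI : p ∈ I :=
    I.sub_mem hfI (I.sum_mem fun τ hτ => I.mul_mem_left _ (hg τ hτ).1)
  have hTlt : ∀ τ ∈ T, ord.le τ σ ∧ ¬ ord.le σ τ := fun τ hτ =>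
    hlt τ (Finset.mem_filter.1 hτ).1 (Finset.mem_filter.1 hτ).2.1
  have hpσ : p.coeff σ = f.coeff σ := by
    rw [hcoeff, Finset.sum_eq_zero, sub_zero]
    intro τ hτ
    rw [MvPolynomial.notMem_support_iff.1 fun h => (hTlt τ hτ).2 ((hg τ hτ).2.1.2 σ h), mul_zero]
  have hple : ∀ ρ ∈ p.support, ord.le ρ σ := by
    intro ρ hρ
    by_contra hn
    refine MvPolynomial.mem_support_iff.1 hρ ?_
    rw [hcoeff, MvPolynomial.notMem_support_iff.1 fun h => hn (hmax ρ h),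
      Finset.sum_eq_zero, sub_zero]
    intro τ hτ
    rw [MvPolynomial.notMem_support_iff.1 fun h =>
      hn (ord.le_trans ((hg τ hτ).2.1.2 ρ h) (hTlt τ hτ).1), mul_zero]
  have hpS : ∀ ρ ∈ p.support, ρ ≠ σ → ρ ∉ S := by
    intro ρ hρ hne hρS
    refine MvPolynomial.mem_support_iff.1 hρ ?_
    have hother : ∀ τ ∈ T, τ ≠ ρ → f.coeff τ * (g τ).coeff ρ = 0 := fun τ hτ hτρ => by
      rw [MvPolynomial.notMem_support_iff.1 fun h => (hg τ hτ).2.2.2 ρ h hτρ.symm hρS, mul_zero]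
    rw [hcoeff]
    by_cases hρf : ρ ∈ f.support
    · have hρT : ρ ∈ T := Finset.mem_filter.2 ⟨hρf, hne, hρS⟩
      rw [Finset.sum_eq_single_of_mem ρ hρT hother, (hg ρ hρT).2.2.1, mul_one, sub_self]
    · rw [Finset.sum_eq_zero, MvPolynomial.notMem_support_iff.1 hρf, sub_zero]
      intro τ hτ
      exact hother τ hτ fun h => hρf (h ▸ (Finset.mem_filter.1 hτ).1)
  have hfσ : f.coeff σ ≠ 0 := MvPolynomial.mem_support_iff.1 hf
  have hsupp : ∀ ρ, ρ ∈ (C (f.coeff σ)⁻¹ * p).support ↔ ρ ∈ p.support := fun ρ => by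
    simp [MvPolynomial.mem_support_iff, coeff_C_mul, hfσ]
  refine ⟨C (f.coeff σ)⁻¹ * p, I.mul_mem_left _ hpI, ⟨?_, ?_⟩, ?_, ?_⟩
  · rw [hsupp, MvPolynomial.mem_support_iff, hpσ]
    exact hfσ
  · exact fun τ hτ => hple τ ((hsupp τ).1 hτ)
  · rw [coeff_C_mul, hpσ, inv_mul_cancel₀ hfσ]
  · exact fun τ hτ => hpS τ ((hsupp τ).1 hτ)

end TermOrder

/-- For every `σ ∈ C` there is a unique monic `f_σ ∈ I` with leading
exponent `σ` all of whose nonleading exponents lie in `D = ℕ^m − C`. -/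
theorem statement_0 {k : Type*} [Field k] {m : ℕ} (ord : TermOrder m)
    (I : Ideal (MvPolynomial (Fin m) k)) (C D : Set (Fin m →₀ ℕ))
    (hC : C = leadExps ord.le (I : Set (MvPolynomial (Fin m) k)))
    (hD : D = Cᶜ)
    (σ : Fin m →₀ ℕ) (hσ : σ ∈ C) :
    ∃! f : MvPolynomial (Fin m) k,
      f ∈ I ∧ IsMaxExp ord.le f σ ∧ f.coeff σ = 1 ∧
        ∀ τ ∈ f.support, τ ≠ σ → τ ∈ D := by
  subst hC hD
  obtain ⟨f, hfI, hfmax, hf1, hfD⟩ := ord.exists_reduced_monic I hσ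
  refine ⟨f, ⟨hfI, hfmax, hf1, hfD⟩, ?_⟩
  rintro g ⟨hgI, -, hg1, hgD⟩
  refine sub_eq_zero.1 (ord.eq_zero_of_support_disjoint_leadExps I (I.sub_mem hgI hfI) ?_)
  intro τ hτ
  have hne : τ ≠ σ := by
    rintro rfl
    simp [hg1, hf1] at hτ
  classical
  rcases Finset.mem_union.1 (support_sub _ g f hτ) with h | h
  exacts [hgD τ h hne, hfD τ h hne]
end

section
/- Let k be a field, let ≤ be an arbitrary term order on k[X₁,…,X_m], let I be an ideal of k[X₁,…,X_m], let C be the set of leading exponents of nonzero elements of I, and for each σ ∈ C let f_σ ∈ I be the unique monic polynomial with leading exponent σ all of whose nonleading exponents lie in D = ℕ^m − C. Then the family (f_σ)_{σ∈C} is a basis of I as a k-vector space. -/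
open MvPolynomial Finsupp

/-- A nonempty finite set of exponents has a greatest element for a term order. -/
theorem TermOrder.exists_greatest {m : ℕ} (ord : TermOrder m) {s : Finset (Fin m →₀ ℕ)}
    (hs : s.Nonempty) : ∃ σ ∈ s, ∀ τ ∈ s, ord.le τ σ := by
  induction hs using Finset.Nonempty.cons_induction with
  | singleton a => exact ⟨a, by simp, by simpa using ord.le_refl a⟩
  | cons a s ha hs ih =>
    obtain ⟨σ, hσ, hmax⟩ := ih
    rcases ord.le_total a σ with h | h
    · exact ⟨σ, by simp [hσ], by simpa using ⟨h, hmax⟩⟩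
    · exact ⟨a, by simp, by simpa using ⟨ord.le_refl a, fun τ hτ => ord.le_trans (hmax τ hτ) h⟩⟩

/-- A member of `S` none of whose exponents is a leading exponent of `S` is zero. -/
theorem eq_zero_of_forall_coeff_leadExps_eq_zero {k : Type*} [CommSemiring k] {m : ℕ}
    (ord : TermOrder m) {S : Set (MvPolynomial (Fin m) k)} {g : MvPolynomial (Fin m) k}
    (hg : g ∈ S) (h : ∀ σ ∈ leadExps ord.le S, g.coeff σ = 0) : g = 0 := by
  by_contra hne
  obtain ⟨σ, hσ, hmax⟩ := ord.exists_greatest (MvPolynomial.support_nonempty.mpr hne)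
  exact MvPolynomial.mem_support_iff.mp hσ (h σ ⟨g, hg, hσ, hmax⟩)

/-- The family `(f_σ)_{σ ∈ C}` is a basis of `I` as a `k`-vector space:
it is linearly independent and spans `I` (viewed as a `k`-submodule). -/
theorem statement_1 {k : Type*} [Field k] {m : ℕ} (ord : TermOrder m)
    (I : Ideal (MvPolynomial (Fin m) k)) (C D : Set (Fin m →₀ ℕ))
    (hC : C = leadExps ord.le (I : Set (MvPolynomial (Fin m) k)))
    (hD : D = Cᶜ)
    (F : (Fin m →₀ ℕ) → MvPolynomial (Fin m) k)
    (hFmem : ∀ σ ∈ C, F σ ∈ I)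
    (hFlead : ∀ σ ∈ C, IsMaxExp ord.le (F σ) σ)
    (hFmonic : ∀ σ ∈ C, (F σ).coeff σ = 1)
    (hFtail : ∀ σ ∈ C, ∀ τ ∈ (F σ).support, τ ≠ σ → τ ∈ D) :
    LinearIndependent k (fun σ : C => F (σ : Fin m →₀ ℕ)) ∧
      Submodule.span k (F '' C) = Submodule.restrictScalars k I := by
  classical
  have hcoeff : ∀ σ ∈ C, ∀ τ ∈ C, (F σ).coeff τ = if σ = τ then 1 else 0 := by
    intro σ hσ τ hτ
    split_ifs with h
    · exact h ▸ hFmonic σ hσ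
    · by_contra hne
      have hτD := hFtail σ hσ τ (MvPolynomial.mem_support_iff.mpr hne) (Ne.symm h)
      rw [hD] at hτD
      exact hτD hτ
  constructor
  · rw [linearIndependent_iff']
    intro s c hsum i hi
    have hi' := congrArg (MvPolynomial.coeff (i : Fin m →₀ ℕ)) hsum
    rw [MvPolynomial.coeff_sum, Finset.sum_eq_single i] at hi'
    · simpa [hFmonic i i.2] using hi'
    · intro j _ hji
      simp [hcoeff j j.2 i i.2, Subtype.coe_injective.ne hji]
    · exact fun h => absurd hi h
  · apply le_antisymm
    · rw [Submodule.span_le]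
      rintro _ ⟨σ, hσ, rfl⟩
      exact hFmem σ hσ
    · intro f hf
      set p := ∑ σ ∈ f.support with σ ∈ C, f.coeff σ • F σ with hp
      have hpspan : p ∈ Submodule.span k (F '' C) :=
        Submodule.sum_mem _ fun σ hσ => Submodule.smul_mem _ _
          (Submodule.subset_span ⟨σ, (Finset.mem_filter.mp hσ).2, rfl⟩)
      have hpI : p ∈ Submodule.restrictScalars k I :=
        Submodule.sum_mem _ fun σ hσ => Submodule.smul_mem _ _
          (hFmem σ (Finset.mem_filter.mp hσ).2)
      have hpcoeff : ∀ τ ∈ C, p.coeff τ = f.coeff τ := by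
        intro τ hτ
        rw [hp, MvPolynomial.coeff_sum, Finset.sum_eq_single τ]
        · simp [hFmonic τ hτ]
        · intro σ hσ hne
          simp [hcoeff σ (Finset.mem_filter.mp hσ).2 τ hτ, hne]
        · intro h
          have : f.coeff τ = 0 := by simpa [hτ] using h
          simp [this]
      have hzero : f - p = 0 :=
        eq_zero_of_forall_coeff_leadExps_eq_zero ord (Submodule.sub_mem _ hf hpI)
          fun σ hσ => by
            rw [MvPolynomial.coeff_sub, hpcoeff σ (hC ▸ hσ), sub_self]
      rwa [sub_eq_zero.mp hzero]
end

section
/- Let k be a field, let ≤ be an arbitrary term order on k[X₁,…,X_m], and let I be a homogeneous ideal of k[X₁,…,X_m]. For each σ in the set C of leading exponents of nonzero elements of I, the unique monic polynomial f_σ ∈ I with leading exponent σ all of whose nonleading exponents lie in ℕ^m − C is homogeneous. -/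
open MvPolynomial Finsupp

/-- Every nonzero polynomial has a leading exponent with respect to a term order. -/
theorem TermOrder.exists_isMaxExp_s2 {k : Type*} [CommSemiring k] {m : ℕ} (ord : TermOrder m)
    {f : MvPolynomial (Fin m) k} (hf : f ≠ 0) : ∃ σ, IsMaxExp ord.le f σ := by
  have h : ∀ s : Finset (Fin m →₀ ℕ), s.Nonempty → ∃ σ ∈ s, ∀ τ ∈ s, ord.le τ σ := by
    intro s hs
    induction hs using Finset.Nonempty.cons_induction with
    | singleton a => exact ⟨a, by simp, by simpa using ord.le_refl a⟩
    | cons a s ha hs ih =>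
      obtain ⟨b, hb, hmax⟩ := ih
      rcases ord.le_total a b with hab | hba
      · refine ⟨b, by simp [hb], fun τ hτ => ?_⟩
        rcases Finset.mem_cons.mp hτ with rfl | h
        exacts [hab, hmax τ h]
      · refine ⟨a, by simp, fun τ hτ => ?_⟩
        rcases Finset.mem_cons.mp hτ with rfl | h
        exacts [ord.le_refl _, ord.le_trans (hmax τ h) hba]
  exact h f.support (MvPolynomial.support_nonempty.mpr hf)

/-- If `I` is a homogeneous ideal, then for each `σ ∈ C` the unique monic
`f ∈ I` with leading exponent `σ` whose nonleading exponents lie in `ℕ^m − C`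
is a homogeneous polynomial. -/
theorem statement_2 {k : Type*} [Field k] {m : ℕ} (ord : TermOrder m)
    (I : Ideal (MvPolynomial (Fin m) k))
    (hI : ∀ f ∈ I, ∀ d : ℕ, MvPolynomial.homogeneousComponent d f ∈ I)
    (C : Set (Fin m →₀ ℕ))
    (hC : C = leadExps ord.le (I : Set (MvPolynomial (Fin m) k)))
    (σ : Fin m →₀ ℕ) (hσ : σ ∈ C)
    (f : MvPolynomial (Fin m) k)
    (hfI : f ∈ I) (hlead : IsMaxExp ord.le f σ) (hmonic : f.coeff σ = 1)
    (htail : ∀ τ ∈ f.support, τ ≠ σ → τ ∉ C) :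
    ∃ d : ℕ, f.IsHomogeneous d := by
  refine ⟨σ.degree, ?_⟩
  intro τ hτ
  by_contra hne
  have hdeg : τ.degree ≠ σ.degree := by
    intro h
    exact hne ((DFunLike.congr_fun degree_eq_weight_one τ).symm.trans h)
  have hcoeff : ∀ ρ, (homogeneousComponent τ.degree f).coeff ρ =
      if ρ.degree = τ.degree then f.coeff ρ else 0 := fun ρ => coeff_homogeneousComponent _ _ ρ
  have hτ' : τ ∈ (homogeneousComponent τ.degree f).support := by
    rw [MvPolynomial.mem_support_iff, hcoeff, if_pos rfl]
    exact hτ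
  obtain ⟨ρ, hρ⟩ := ord.exists_isMaxExp_s2 (MvPolynomial.support_nonempty.mp ⟨τ, hτ'⟩)
  have hρC : ρ ∈ C := hC ▸ ⟨_, hI f hfI _, hρ⟩
  have hρs := hρ.1
  rw [MvPolynomial.mem_support_iff, hcoeff, ne_eq, ite_eq_right_iff, Classical.not_imp] at hρs
  refine htail ρ (MvPolynomial.mem_support_iff.mpr hρs.2) ?_ hρC
  rintro rfl
  exact hdeg hρs.1.symm
end

section
/- Let k be a field and let h ∈ k[X₁,…,X_{n+1}] be a nonzero homogeneous polynomial such that h(1,X₂,…,X_{n+1}) ≠ 0. Then the leading exponent of h(1,X₂,…,X_{n+1}) ∈ k[X₂,…,X_{n+1}] with respect to the lexicographic order (with X₂ < … < X_{n+1}) equals π(𝓔_deglex(h)), where 𝓔_deglex(h) is the leading exponent of h with respect to the graded lexicographic order on k[X₁,…,X_{n+1}] (with X₁ < … < X_{n+1}) and π: ℕ^{n+1} → ℕⁿ is the projection deleting the first coordinate. -/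
open MvPolynomial Finsupp

theorem piProj_apply {n : ℕ} (γ : Fin (n + 1) →₀ ℕ) (i : Fin n) :
    piProj γ i = γ i.succ := rfl

theorem degOf_eq_add_sum {n : ℕ} (γ : Fin (n + 1) →₀ ℕ) :
    degOf γ = γ 0 + ∑ i : Fin n, γ i.succ := by
  rw [degOf, Finsupp.sum_fintype _ _ (fun _ => rfl), Fin.sum_univ_succ]

/-- An exponent vector is determined by its total degree and its projection. -/
theorem eq_of_piProj_eq_of_degOf_eq {n : ℕ} {γ δ : Fin (n + 1) →₀ ℕ}
    (hp : piProj γ = piProj δ) (hd : degOf γ = degOf δ) : γ = δ := by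
  have hs (i : Fin n) : γ i.succ = δ i.succ := DFunLike.congr_fun hp i
  simp only [degOf_eq_add_sum, hs, Nat.add_right_cancel_iff] at hd
  ext i
  cases i using Fin.cases with
  | zero => exact hd
  | succ i => exact hs i

theorem lexLt.piProj_of_degOf_eq {n : ℕ} {γ δ : Fin (n + 1) →₀ ℕ}
    (hlt : lexLt γ δ) (hd : degOf γ = degOf δ) : lexLt (piProj γ) (piProj δ) := by
  obtain ⟨j, hj, hgt⟩ := hlt
  cases j using Fin.cases with
  | zero =>
    have hs (i : Fin n) : γ i.succ = δ i.succ := hgt _ (Fin.succ_pos i)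
    simp only [degOf_eq_add_sum, hs, Nat.add_right_cancel_iff] at hd
    exact absurd hd hj.ne
  | succ j => exact ⟨j, hj, fun i hi => hgt _ (Fin.succ_lt_succ_iff.mpr hi)⟩

theorem degLexLe.lexLe_piProj {n : ℕ} {γ δ : Fin (n + 1) →₀ ℕ}
    (hle : degLexLe γ δ) (hd : degOf γ = degOf δ) : lexLe (piProj γ) (piProj δ) := by
  rcases hle with rfl | hlt | ⟨-, hlt⟩
  · exact Or.inl rfl
  · exact absurd hd hlt.ne
  · exact Or.inr (hlt.piProj_of_degOf_eq hd)

theorem MvPolynomial.IsHomogeneous.degOf_eq {R : Type*} [CommSemiring R] {m d : ℕ}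
    {f : MvPolynomial (Fin m) R} (hf : f.IsHomogeneous d) {α : Fin m →₀ ℕ}
    (hα : α ∈ f.support) : degOf α = d :=
  (hf.degree_eq_sum_deg_support hα).symm

/-- Dehomogenization sends each monomial to the monomial with the projected exponent. -/
theorem dehom_eq_sum {R : Type*} [CommSemiring R] {n : ℕ} (h : MvPolynomial (Fin (n + 1)) R) :
    dehom h = ∑ α ∈ h.support, monomial (piProj α) (h.coeff α) := by
  rw [dehom, aeval_def, eval₂_eq']
  refine Finset.sum_congr rfl fun α _ => ?_
  rw [monomial_eq, Finsupp.prod_fintype _ _ (fun _ => pow_zero _), Fin.prod_univ_succ]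
  simp [piProj_apply, algebraMap_eq]

theorem coeff_dehom {R : Type*} [CommSemiring R] {n : ℕ} (h : MvPolynomial (Fin (n + 1)) R)
    (β : Fin n →₀ ℕ) :
    (dehom h).coeff β = ∑ α ∈ h.support, if piProj α = β then h.coeff α else 0 := by
  simp [dehom_eq_sum, coeff_sum, coeff_monomial]

theorem exists_piProj_eq_of_mem_support_dehom {R : Type*} [CommSemiring R] {n : ℕ}
    {h : MvPolynomial (Fin (n + 1)) R} {β : Fin n →₀ ℕ} (hβ : β ∈ (dehom h).support) :
    ∃ α ∈ h.support, piProj α = β := by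
  rw [MvPolynomial.mem_support_iff, coeff_dehom] at hβ
  obtain ⟨α, hα, hne⟩ := Finset.exists_ne_zero_of_sum_ne_zero hβ
  exact ⟨α, hα, by by_contra hc; exact hne (if_neg hc)⟩

/-- No cancellation occurs when dehomogenizing a homogeneous polynomial. -/
theorem MvPolynomial.IsHomogeneous.coeff_dehom_piProj {R : Type*} [CommSemiring R] {n d : ℕ}
    {h : MvPolynomial (Fin (n + 1)) R} (hh : h.IsHomogeneous d) {γ : Fin (n + 1) →₀ ℕ}
    (hγ : γ ∈ h.support) : (dehom h).coeff (piProj γ) = h.coeff γ := by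
  rw [coeff_dehom, Finset.sum_eq_single_of_mem γ hγ, if_pos rfl]
  intro α hα hne
  exact if_neg fun hp =>
    hne (eq_of_piProj_eq_of_degOf_eq hp ((hh.degOf_eq hα).trans (hh.degOf_eq hγ).symm))

/-- For a nonzero homogeneous `h ∈ k[X₁,…,X_{n+1}]` with `h(1,X) ≠ 0`, the
lexicographic leading exponent of `h(1,X)` is `π(𝓔_deglex(h))`. -/
theorem statement_6 {k : Type*} [Field k] {n : ℕ}
    (h : MvPolynomial (Fin (n + 1)) k) (hne : h ≠ 0)
    (hhom : ∃ d : ℕ, h.IsHomogeneous d) (hdne : dehom h ≠ 0)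
    (γ : Fin (n + 1) →₀ ℕ) (hγ : IsMaxExp degLexLe h γ) :
    IsMaxExp lexLe (dehom h) (piProj γ) := by
  obtain ⟨d, hd⟩ := hhom
  refine ⟨?_, fun τ hτ => ?_⟩
  · rw [MvPolynomial.mem_support_iff, hd.coeff_dehom_piProj hγ.1]
    exact MvPolynomial.mem_support_iff.mp hγ.1
  · obtain ⟨α, hα, rfl⟩ := exists_piProj_eq_of_mem_support_dehom hτ
    exact (hγ.2 α hα).lexLe_piProj ((hd.degOf_eq hα).trans (hd.degOf_eq hγ.1).symm)
end
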